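/- Let p ≥ 1 be an integer and let (a₀,a₂) : (−1,1) → ℝ be a differentiable solution of the homogeneous system S_{p,p}, i.e. with c := (p+1)/2: (1+τ)·a₀′(τ) + (c·(1+τ) − p + 1)·a₀(τ) + c·(1−τ)·a₂(τ) = 0 and (1−τ)·a₂′(τ) − c·(1+τ)·a₀(τ) + (−c·(1−τ) + p − 1)·a₂(τ) = 0. Then a₀ and a₂ are restrictions to (−1,1) of polynomial functions if and only if a₀(0) = a₂(0). -/

import Mathlib

lemma const_aux (f : ℝ → ℝ) (h : ∀ τ ∈ Set.Ioo (-1 : ℝ) 1, HasDerivAt f 0 τ) :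
    ∀ τ ∈ Set.Ioo (-1 : ℝ) 1, f τ = f 0 := by
  intro τ hτ
  exact isOpen_Ioo.is_const_of_deriv_eq_zero isPreconnected_Ioo
    (fun t ht => (h t ht).differentiableAt.differentiableWithinAt)
    (fun t ht => (h t ht).deriv) hτ (by norm_num)

open Polynomial in
lemma poly_aux (m : ℕ) (K : ℝ) (R : Polynomial ℝ)
    (h : X * (C 2 * derivative R) - X * (X * derivative R)
      = C (2 * (m : ℝ)) * R - C (2 * ((m : ℝ) + 1)) * (X * R) + C K) : K = 0 := by
  by_contra hK
  have h0 := congrArg (fun q => coeff q 0) h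
  simp only [coeff_sub, coeff_add, coeff_C_mul, coeff_X_mul_zero, coeff_C_zero] at h0
  have hs : ∀ k : ℕ, 2 * ((k : ℝ) + 1 - m) * R.coeff (k + 1)
      = ((k : ℝ) - 2 * (m + 1)) * R.coeff k := by
    intro k
    have h1 := congrArg (fun q => coeff q (k + 1)) h
    simp only [coeff_sub, coeff_add, coeff_C_mul, coeff_X_mul, coeff_C_succ,
      coeff_derivative] at h1
    have h2 : (X * derivative R).coeff k = k * R.coeff k := by
      cases k with
      | zero => simp
      | succ k => simp [coeff_X_mul, coeff_derivative]; ring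
    rw [h2] at h1
    linarith
  have hne : ∀ k : ℕ, k ≤ m → R.coeff k ≠ 0 := by
    intro k
    induction k with
    | zero =>
      intro _ hz
      rw [hz] at h0
      apply hK
      linarith
    | succ k ih =>
      intro hk hz
      have h1 := hs k
      rw [hz, mul_zero] at h1
      have hk' : (k : ℝ) + 1 ≤ m := by exact_mod_cast hk
      rcases mul_eq_zero.mp h1.symm with h2 | h2
      · have : (0 : ℝ) ≤ m := Nat.cast_nonneg m
        linarith
      · exact ih (by omega) h2
  cases m with
  | zero => apply hK; simp at h0; linarith
  | succ n =>
    have h1 := hs n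
    push_cast at h1
    have hz : ((n : ℝ) - 2 * (n + 1 + 1)) * R.coeff n = 0 := by rw [← h1]; ring
    rcases mul_eq_zero.mp hz with h2 | h2
    · have : (0 : ℝ) ≤ n := Nat.cast_nonneg n
      linarith
    · exact hne n (by omega) h2

/-- For the homogeneous system `S_{p,p}` (the `2^p`-polar sector of the order-`p`
Maxwell transport equations, with `c = (p+1)/2`), a differentiable solution on
`(-1,1)` is polynomial if and only if the regularity condition `a₀ 0 = a₂ 0` holds. -/
theorem Spp_polynomial_iff_regularity (p : ℕ) (hp : 1 ≤ p) (a₀ a₂ : ℝ → ℝ)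
    (hd₀ : ∀ τ ∈ Set.Ioo (-1 : ℝ) 1, DifferentiableAt ℝ a₀ τ)
    (hd₂ : ∀ τ ∈ Set.Ioo (-1 : ℝ) 1, DifferentiableAt ℝ a₂ τ)
    (heq₀ : ∀ τ ∈ Set.Ioo (-1 : ℝ) 1,
      (1 + τ) * deriv a₀ τ + (((p : ℝ) + 1) / 2 * (1 + τ) - (p : ℝ) + 1) * a₀ τ
        + ((p : ℝ) + 1) / 2 * (1 - τ) * a₂ τ = 0)
    (heq₂ : ∀ τ ∈ Set.Ioo (-1 : ℝ) 1,
      (1 - τ) * deriv a₂ τ - ((p : ℝ) + 1) / 2 * (1 + τ) * a₀ τ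
        + (-(((p : ℝ) + 1) / 2) * (1 - τ) + (p : ℝ) - 1) * a₂ τ = 0) :
    (∃ P Q : Polynomial ℝ, ∀ τ ∈ Set.Ioo (-1 : ℝ) 1, a₀ τ = P.eval τ ∧ a₂ τ = Q.eval τ)
      ↔ a₀ 0 = a₂ 0 := by
  obtain ⟨m, rfl⟩ : ∃ m, p = m + 1 := ⟨p - 1, by omega⟩
  push_cast at heq₀ heq₂
  have hF : ∀ τ ∈ Set.Ioo (-1 : ℝ) 1,
      (1 + τ) ^ 2 * a₀ τ - (1 - τ) ^ 2 * a₂ τ = a₀ 0 - a₂ 0 := by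
    intro τ hτ
    have := const_aux (fun t => (1 + t) ^ 2 * a₀ t - (1 - t) ^ 2 * a₂ t) ?_ τ hτ
    · simpa using this
    intro t ht
    have e1 : HasDerivAt (fun t : ℝ => (1 + t) ^ 2) (2 * (1 + t)) t := by
      exact (((hasDerivAt_id t).const_add 1).pow 2).congr_deriv (by simp)
    have e2 : HasDerivAt (fun t : ℝ => (1 - t) ^ 2) (-(2 * (1 - t))) t := by
      exact (((hasDerivAt_id t).const_sub 1).pow 2).congr_deriv (by simp)
    refine ((e1.mul (hd₀ t ht).hasDerivAt).sub (e2.mul (hd₂ t ht).hasDerivAt)).congr_deriv ?_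
    linear_combination (1 + t) * heq₀ t ht - (1 - t) * heq₂ t ht
  have hode : ∀ τ ∈ Set.Ioo (-1 : ℝ) 1, (1 + τ) * (1 - τ) * deriv a₀ τ
      = (m * (1 - τ) - (m + 2) * (1 + τ)) * a₀ τ
        + ((m : ℝ) + 1 + 1) / 2 * (a₀ 0 - a₂ 0) := by
    intro τ hτ
    linear_combination (1 - τ) * heq₀ τ hτ + ((m : ℝ) + 1 + 1) / 2 * hF τ hτ
  constructor
  · rintro ⟨P, Q, hPQ⟩
    have hdP : ∀ τ ∈ Set.Ioo (-1 : ℝ) 1, deriv a₀ τ = (Polynomial.derivative P).eval τ := by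
      intro τ hτ
      have : a₀ =ᶠ[nhds τ] fun t => P.eval t := by
        filter_upwards [isOpen_Ioo.mem_nhds hτ] with t ht using (hPQ t ht).1
      rw [this.deriv_eq, Polynomial.deriv]
    have key := poly_aux m (((m : ℝ) + 1 + 1) / 2 * (a₀ 0 - a₂ 0))
      (P.comp (Polynomial.X - Polynomial.C 1)) ?_
    · have hm : ((m : ℝ) + 1 + 1) / 2 ≠ 0 := by positivity
      have := (mul_eq_zero.mp key).resolve_left hm
      linarith
    · apply Polynomial.eq_of_infinite_eval_eq
      refine Set.Infinite.mono ?_ (Set.Ioo_infinite (show (0 : ℝ) < 2 by norm_num))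
      intro x hx
      have hτ : x - 1 ∈ Set.Ioo (-1 : ℝ) 1 := ⟨by linarith [hx.1], by linarith [hx.2]⟩
      have h1 := hode _ hτ
      rw [hdP _ hτ, (hPQ _ hτ).1] at h1
      simp only [Set.mem_ofPred_eq, Polynomial.eval_add, Polynomial.eval_sub, Polynomial.eval_mul,
        Polynomial.eval_C, Polynomial.eval_X, Polynomial.derivative_comp, Polynomial.eval_comp,
        Polynomial.derivative_sub, Polynomial.derivative_X, Polynomial.derivative_C,
        Polynomial.eval_one, Polynomial.eval_zero]
      linear_combination h1
  · intro h0
    have hu : ∀ τ ∈ Set.Ioo (-1 : ℝ) 1,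
        a₀ τ = a₀ 0 * ((1 - τ) ^ (m + 2) * (1 + τ) ^ m) := by
      intro τ hτ
      have := const_aux (fun t => a₀ t / ((1 - t) ^ (m + 2) * (1 + t) ^ m)) ?_ τ hτ
      · have hx : 0 < 1 + τ := by linarith [hτ.1]
        have hy : 0 < 1 - τ := by linarith [hτ.2]
        simp only [sub_zero, add_zero, one_pow, mul_one, div_one] at this
        rwa [div_eq_iff (by positivity)] at this
      intro t ht
      have hx : 0 < 1 + t := by linarith [ht.1]
      have hy : 0 < 1 - t := by linarith [ht.2]
      have e1 : HasDerivAt (fun t : ℝ => (1 + t) ^ m) (m * (1 + t) ^ m / (1 + t)) t := by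
        refine (((hasDerivAt_id t).const_add 1).pow m).congr_deriv ?_
        cases m with
        | zero => simp
        | succ n => simp; field_simp; ring
      have e2 : HasDerivAt (fun t : ℝ => (1 - t) ^ (m + 2))
          (-((m + 2) * (1 - t) ^ (m + 1))) t := by
        exact (((hasDerivAt_id t).const_sub 1).pow (m + 2)).congr_deriv (by simp)
      refine ((hd₀ t ht).hasDerivAt.div (e2.mul e1) (ne_of_gt (by simp only [Pi.mul_apply]; positivity))).congr_deriv ?_
      have h1 := hode t ht
      rw [h0, sub_self, mul_zero, add_zero] at h1
      simp only [Pi.mul_apply]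
      rw [div_eq_zero_iff]
      left
      field_simp
      linear_combination ((1 - t) ^ (m + 1) * (1 + t) ^ m) * h1
    refine ⟨Polynomial.C (a₀ 0) * ((1 - Polynomial.X) ^ (m + 2) * (1 + Polynomial.X) ^ m),
      Polynomial.C (a₀ 0) * ((1 - Polynomial.X) ^ m * (1 + Polynomial.X) ^ (m + 2)), ?_⟩
    intro τ hτ
    have hy : 1 - τ ≠ 0 := (sub_pos.mpr hτ.2).ne'
    refine ⟨by simpa using hu τ hτ, ?_⟩
    have h1 := hF τ hτ
    have h2 := hu τ hτ
    simp only [Polynomial.eval_mul, Polynomial.eval_C, Polynomial.eval_pow, Polynomial.eval_sub,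
      Polynomial.eval_add, Polynomial.eval_one, Polynomial.eval_X]
    apply mul_left_cancel₀ (pow_ne_zero 2 hy)
    linear_combination (1 + τ) ^ 2 * h2 - h1 - h0
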